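/- Let (X, 𝓑, μ, f) be a dissipative system generated by W, with f bijective and both f and f⁻¹ satisfying condition (⋆), and let 1 ≤ p < ∞. Assume that for each k ∈ ℤ the measure B ↦ μ(f^k(B)) is absolutely continuous with respect to μ with Radon–Nikodym derivative ρ_k, set m_k = ess inf_{x∈W} ρ_k(x) and M_k = ess sup_{x∈W} ρ_k(x), and assume { M_k/m_k : k ∈ ℤ } is bounded. Then the composition operator T_f on L^p(X, μ) has the shadowing property if and only if at least one of the following holds: (𝓡𝓝𝓒) limsup_{n→∞} sup_{k∈ℤ} (M_k/m_{k+n})^{1/n} < 1; (𝓡𝓝𝓓) liminf_{n→∞} inf_{k∈ℤ} (M_k/m_{k+n})^{1/n} > 1; (𝓡𝓝𝓖𝓗) limsup_{n→∞} sup_{k≤0} (M_{k−n}/m_k)^{1/n} < 1 and liminf_{n→∞} inf_{k≥0} (M_k/m_{k+n})^{1/n} > 1. Moreover, (𝓡𝓝𝓒), (𝓡𝓝𝓓), (𝓡𝓝𝓖𝓗) imply, respectively, that T_f is a contraction (spectral radius < 1), a dilation (spectral radius of T_f⁻¹ < 1), and generalized hyperbolic. -/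

import Mathlib

open MeasureTheory Filter Set Function Topology ENNReal

noncomputable section

namespace GHShadow

/-- The shadowing property for an invertible bounded linear operator. -/
def HasShadowing {E : Type*} [NormedAddCommGroup E] [NormedSpace ℝ E]
    (T : E ≃L[ℝ] E) : Prop :=
  ∀ ε : ℝ, 0 < ε → ∃ δ : ℝ, 0 < δ ∧ ∀ x : ℤ → E,
    (∀ n : ℤ, ‖T (x n) - x (n + 1)‖ ≤ δ) →
      ∃ y : E, ∀ n : ℤ, ‖(T ^ n) y - x n‖ < ε

/-- `lim ‖Tⁿ‖^{1/n}` exists and is `< 1`. -/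
def SpectralRadiusLtOne {E : Type*} [NormedAddCommGroup E] [NormedSpace ℝ E]
    (T : E →L[ℝ] E) : Prop :=
  ∃ r : ℝ, r < 1 ∧ Tendsto (fun n : ℕ => ‖T ^ n‖ ^ (1 / (n : ℝ))) atTop (nhds r)

/-- The restriction of `T` to `M` has spectral radius `< 1`
(equivalently, is a proper contraction in an equivalent norm). -/
def ContractsOn {E : Type*} [NormedAddCommGroup E] [NormedSpace ℝ E]
    (T : E ≃L[ℝ] E) (M : Submodule ℝ E) : Prop :=
  ∃ C : ℝ, 0 < C ∧ ∃ t : ℝ, 0 < t ∧ t < 1 ∧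
    ∀ n : ℕ, ∀ x ∈ M, ‖(T ^ n) x‖ ≤ C * t ^ n * ‖x‖

def GeneralizedHyperbolic {E : Type*} [NormedAddCommGroup E] [NormedSpace ℝ E]
    (T : E ≃L[ℝ] E) : Prop :=
  ∃ M N : Submodule ℝ E, IsClosed (M : Set E) ∧ IsClosed (N : Set E) ∧
    IsCompl M N ∧ (∀ x ∈ M, T x ∈ M) ∧ (∀ x ∈ N, T.symm x ∈ N) ∧
    ContractsOn T M ∧ ContractsOn T.symm N

variable {X : Type*} [MeasurableSpace X]

/-- image of `B` under the `k`-th iterate of the invertible map `f`. -/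
def img (f : Equiv.Perm X) (k : ℤ) (B : Set X) : Set X := ⇑(f ^ k) '' B

/-- `(X, 𝓑, μ, f)` is a dissipative system generated by `W`. -/
structure IsDissipative (μ : Measure X) (f : Equiv.Perm X) (W : Set X) : Prop where
  sigmaFin : SigmaFinite μ
  meas_f : Measurable f
  meas_symm : Measurable f.symm
  meas_W : MeasurableSet W
  pos : 0 < μ W
  fin : μ W < ⊤
  disj : Pairwise fun k l : ℤ => Disjoint (img f k W) (img f l W)
  cover : (⋃ k : ℤ, img f k W) = univ

/-- `f` is of bounded distortion on `W` with constant `K`. -/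
def BoundedDistortion (μ : Measure X) (f : Equiv.Perm X) (W : Set X) (K : ℝ≥0∞) : Prop :=
  ∀ k : ℤ, ∀ B : Set X, MeasurableSet B → B ⊆ W →
    (1 / K) * (μ (img f k W) * μ B) ≤ μ (img f k B) * μ W ∧
      μ (img f k B) * μ W ≤ K * (μ (img f k W) * μ B)

/-- condition (⋆) for a transformation `g`. -/
def CondStar (μ : Measure X) (g : X → X) : Prop :=
  ∃ c : ℝ≥0∞, 0 < c ∧ c ≠ ⊤ ∧ ∀ B : Set X, MeasurableSet B → μ (g ⁻¹' B) ≤ c * μ B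

/-- condition 𝓗𝓒. -/
def CondHC (μ : Measure X) (f : Equiv.Perm X) (W : Set X) : Prop :=
  limsup (fun n : ℕ =>
    ⨆ k : ℤ, (μ (img f k W) / μ (img f (k + (n : ℤ)) W)) ^ (1 / (n : ℝ))) atTop < 1

/-- condition 𝓗𝓓. -/
def CondHD (μ : Measure X) (f : Equiv.Perm X) (W : Set X) : Prop :=
  1 < liminf (fun n : ℕ =>
    ⨅ k : ℤ, (μ (img f k W) / μ (img f (k + (n : ℤ)) W)) ^ (1 / (n : ℝ))) atTop

/-- condition 𝓖𝓗. -/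
def CondGH (μ : Measure X) (f : Equiv.Perm X) (W : Set X) : Prop :=
  limsup (fun n : ℕ =>
      ⨆ m : ℕ, (μ (img f (-(m : ℤ) - (n : ℤ)) W) / μ (img f (-(m : ℤ)) W)) ^ (1 / (n : ℝ)))
      atTop < 1 ∧
  1 < liminf (fun n : ℕ =>
      ⨅ m : ℕ, (μ (img f (m : ℤ) W) / μ (img f ((m : ℤ) + (n : ℤ)) W)) ^ (1 / (n : ℝ))) atTop

/-- `T` represents the composition operator `φ ↦ φ ∘ f` on `L^p(X,μ)`. -/
def RepsComp (μ : Measure X) (p : ℝ≥0∞) [Fact (1 ≤ p)] (f : X → X)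
    (T : Lp ℝ p μ ≃L[ℝ] Lp ℝ p μ) : Prop :=
  ∀ φ : Lp ℝ p μ, ⇑(T φ) =ᵐ[μ] fun x => (φ : X → ℝ) (f x)

section Operators

variable {E : Type*} [NormedAddCommGroup E] [NormedSpace ℝ E]

theorem pow_succ_apply (T : E ≃L[ℝ] E) (n : ℕ) (x : E) : (T ^ (n + 1)) x = T ((T ^ n) x) := by
  rw [pow_succ']; rfl

theorem zpow_add_apply (T : E ≃L[ℝ] E) (k l : ℤ) (x : E) :
    (T ^ (k + l)) x = (T ^ k) ((T ^ l) x) := by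
  rw [zpow_add]; rfl

theorem zpow_add_one_apply (T : E ≃L[ℝ] E) (n : ℤ) (x : E) :
    (T ^ (n + 1)) x = T ((T ^ n) x) := by
  rw [add_comm, zpow_add_apply, zpow_one]

/-- An orbit indexed by `ℤ` is determined by its value at `0`. -/
theorem eq_zpow_apply_of_forall_succ (T : E ≃L[ℝ] E) {e : ℤ → E}
    (he : ∀ n, e (n + 1) = T (e n)) (n : ℤ) : e n = (T ^ n) (e 0) := by
  induction n using Int.induction_on with
  | zero => rfl
  | succ i ih => rw [he, ih, zpow_add_one_apply]
  | pred i ih =>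
    apply T.injective
    rw [← he, ← zpow_add_one_apply, sub_add_cancel, ih]

/-- An inhomogeneous recursion with a bounded forcing term in a contracted closed subspace has
a bounded solution. -/
theorem ContractsOn.exists_bounded_solution [CompleteSpace E] {S : E ≃L[ℝ] E}
    {M : Submodule ℝ E} (h : ContractsOn S M) :
    ∃ H : ℝ, 0 ≤ H ∧ ∀ (b : ℝ) (w : ℤ → E), (∀ n, w n ∈ M) → (∀ n, ‖w n‖ ≤ b) →
      ∃ d : ℤ → E, (∀ n, d (n + 1) = S (d n) + w n) ∧ ∀ n, ‖d n‖ ≤ H * b := by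
  obtain ⟨C, hC, t, ht0, ht1, hct⟩ := h
  refine ⟨C * (1 - t)⁻¹, by have := sub_pos.2 ht1; positivity, fun b w hwM hwb => ?_⟩
  have hbd : ∀ (n : ℤ) (j : ℕ), ‖(S ^ j) (w (n - 1 - j))‖ ≤ C * b * t ^ j := fun n j => by
    refine (hct j _ (hwM _)).trans ?_
    calc C * t ^ j * ‖w (n - 1 - j)‖ ≤ C * t ^ j * b :=
          mul_le_mul_of_nonneg_left (hwb _) (by positivity)
      _ = C * b * t ^ j := by ring
  have hgeo : HasSum (fun j : ℕ => C * b * t ^ j) (C * b * (1 - t)⁻¹) :=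
    (hasSum_geometric_of_lt_one ht0.le ht1).mul_left _
  have hsum : ∀ n : ℤ, Summable fun j : ℕ => (S ^ j) (w (n - 1 - j)) := fun n =>
    Summable.of_norm_bounded hgeo.summable (hbd n)
  refine ⟨fun n => ∑' j : ℕ, (S ^ j) (w (n - 1 - j)), fun n => ?_, fun n => ?_⟩
  · dsimp only
    rw [(hsum (n + 1)).tsum_eq_zero_add, S.map_tsum, add_comm]
    congr 1
    · refine tsum_congr fun j => ?_
      rw [pow_succ_apply]
      congr 3
      push_cast
      ring
    · rw [pow_zero, Nat.cast_zero, sub_zero, add_sub_cancel_right]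
      rfl
  · refine (tsum_of_norm_bounded hgeo (hbd n)).trans_eq ?_
    ring

theorem GeneralizedHyperbolic.hasShadowing [CompleteSpace E] {T : E ≃L[ℝ] E}
    (h : GeneralizedHyperbolic T) : HasShadowing T := by
  obtain ⟨M, N, hM, hN, hMN, -, hTN, hcM, hcN⟩ := h
  obtain ⟨H₁, hH₁, hs₁⟩ := hcM.exists_bounded_solution
  obtain ⟨H₂, hH₂, hs₂⟩ := hcN.exists_bounded_solution
  have htop := Submodule.IsCompl.isTopCompl_of_isClosed hMN hM hN
  obtain ⟨P, hPM, hPN⟩ : ∃ P : E →L[ℝ] E, (∀ x, P x ∈ M) ∧ ∀ x, x - P x ∈ N :=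
    ⟨M.projectionL N htop, fun x => Submodule.projection_apply_mem hMN x,
      fun x => Submodule.sub_projection_mem hMN x⟩
  set Q : E →L[ℝ] E := (T.symm : E →L[ℝ] E) ∘L (ContinuousLinearMap.id ℝ E - P) with hQ
  intro ε hε
  set L := H₁ * ‖P‖ + H₂ * ‖Q‖ + 1 with hL
  have hLpos : 0 < L := by positivity
  refine ⟨ε / (2 * L), by positivity, fun x hx => ?_⟩
  set δ := ε / (2 * L) with hδ
  set z : ℤ → E := fun n => x (n + 1) - T (x n) with hz
  have hzδ : ∀ n, ‖z n‖ ≤ δ := fun n => by rw [hz, norm_sub_rev]; exact hx n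
  obtain ⟨d, hd, hdb⟩ := hs₁ (‖P‖ * δ) (fun n => P (z n)) (fun n => hPM _)
    fun n => P.le_of_opNorm_le_of_le le_rfl (hzδ n)
  obtain ⟨e, he, heb⟩ := hs₂ (‖Q‖ * δ) (fun n => Q (z (-n - 1)))
    (fun n => hTN _ (hPN _)) fun n => Q.le_of_opNorm_le_of_le le_rfl (hzδ _)
  have key : ∀ n, (fun n => x n - (d n - e (-n))) (n + 1)
      = T ((fun n => x n - (d n - e (-n))) n) := fun n => by
    have h1 := he (-n - 1)
    have h2 : -n - 1 + 1 = -n := by ring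
    have h3 : -(-n - 1) - 1 = n := by ring
    have h4 : -(n + 1) = -n - 1 := by ring
    rw [h2, h3] at h1
    have h5 : T (e (-n)) = e (-n - 1) + (z n - P (z n)) := by
      rw [h1, hQ]; simp
    simp only [h4, hd, map_sub, h5]
    simp only [hz]
    abel
  refine ⟨x 0 - (d 0 - e (-0)), fun n => ?_⟩
  have h1 := eq_zpow_apply_of_forall_succ T (e := fun n => x n - (d n - e (-n))) key n
  rw [← h1]
  have h2 : x n - (d n - e (-n)) - x n = -(d n - e (-n)) := by abel
  rw [h2, norm_neg]
  calc ‖d n - e (-n)‖ ≤ ‖d n‖ + ‖e (-n)‖ := norm_sub_le _ _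
    _ ≤ H₁ * (‖P‖ * δ) + H₂ * (‖Q‖ * δ) := add_le_add (hdb _) (heb _)
    _ ≤ L * δ := by
      have : 0 ≤ δ := by positivity
      nlinarith
    _ = ε / 2 := by rw [hδ]; field_simp
    _ < ε := half_lt_self hε

theorem generalizedHyperbolic_of_contractsOn_top {T : E ≃L[ℝ] E} (h : ContractsOn T ⊤) :
    GeneralizedHyperbolic T :=
  ⟨⊤, ⊥, isClosed_univ, by simp, isCompl_top_bot, by simp, by simp, h,
    1, one_pos, 1 / 2, by norm_num, by norm_num, by simp⟩

theorem generalizedHyperbolic_of_symm_contractsOn_top {T : E ≃L[ℝ] E}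
    (h : ContractsOn T.symm ⊤) : GeneralizedHyperbolic T :=
  ⟨⊥, ⊤, by simp, isClosed_univ, isCompl_bot_top, by simp, by simp,
    ⟨1, one_pos, 1 / 2, by norm_num, by norm_num, by simp⟩, h⟩

theorem ContractsOn.spectralRadiusLtOne [Nontrivial E] {T : E ≃L[ℝ] E}
    (h : ContractsOn T ⊤) : SpectralRadiusLtOne (T : E →L[ℝ] E) := by
  obtain ⟨C, hC, t, ht0, ht1, hct⟩ := h
  have hcoe : ∀ n : ℕ, ∀ x, ((T : E →L[ℝ] E) ^ n) x = (T ^ n) x := fun n => by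
    induction n with
    | zero => intro x; rfl
    | succ n ih => intro x; rw [pow_succ_apply, ← ih, pow_succ']; rfl
  have hpos : ∀ n : ℕ, 0 < ‖(T : E →L[ℝ] E) ^ n‖ := fun n => by
    rw [norm_pos_iff]
    intro h0
    obtain ⟨x, hx⟩ := exists_ne (0 : E)
    have h1 := hcoe n x
    rw [h0] at h1
    exact hx ((T ^ n).injective (by simpa using h1.symm))
  have hle : ∀ n : ℕ, ‖(T : E →L[ℝ] E) ^ n‖ ≤ C * t ^ n := fun n =>
    ContinuousLinearMap.opNorm_le_bound _ (by positivity) fun x => by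
      rw [hcoe]; exact hct n x trivial
  set u : ℕ → ℝ := fun n => Real.log ‖(T : E →L[ℝ] E) ^ n‖ with hu
  have hsub : Subadditive u := fun a b => by
    simp only [hu]
    rw [← Real.log_mul (hpos a).ne' (hpos b).ne', pow_add]
    refine Real.log_le_log ?_ (norm_mul_le _ _)
    rw [← pow_add]
    exact hpos _
  set B := ‖(T.symm : E →L[ℝ] E)‖ with hB
  have hBpos : 0 < B := by
    rw [hB, norm_pos_iff]
    intro h0
    obtain ⟨x, hx⟩ := exists_ne (0 : E)
    have h1 : (T.symm : E →L[ℝ] E) x = 0 := by rw [h0]; rfl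
    exact hx (T.symm.injective (by simpa using h1))
  have hinv : ∀ n : ℕ, ∀ x : E, ‖x‖ ≤ B ^ n * ‖(T ^ n) x‖ := fun n => by
    induction n with
    | zero => intro x; rw [pow_zero, one_mul]; rfl
    | succ n ih =>
      intro x
      refine (ih x).trans ?_
      have h1 := (T.symm : E →L[ℝ] E).le_opNorm ((T ^ (n + 1)) x)
      rw [pow_succ_apply] at h1 ⊢
      simp only [ContinuousLinearEquiv.coe_coe, ContinuousLinearEquiv.symm_apply_apply] at h1
      calc B ^ n * ‖(T ^ n) x‖ ≤ B ^ n * (B * ‖T ((T ^ n) x)‖) :=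
            mul_le_mul_of_nonneg_left h1 (by positivity)
        _ = _ := by ring
  have hlow : ∀ n : ℕ, 1 ≤ B ^ n * ‖(T : E →L[ℝ] E) ^ n‖ := fun n => by
    obtain ⟨x, hx⟩ := exists_ne (0 : E)
    have hx' := norm_pos_iff.2 hx
    have h1 := hinv n x
    have h2 := ((T : E →L[ℝ] E) ^ n).le_opNorm x
    rw [hcoe] at h2
    have h3 : 1 * ‖x‖ ≤ B ^ n * ‖(T : E →L[ℝ] E) ^ n‖ * ‖x‖ := by
      rw [one_mul, mul_assoc]
      exact h1.trans (mul_le_mul_of_nonneg_left h2 (by positivity))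
    exact le_of_mul_le_mul_right h3 hx'
  have hbdd : BddBelow (Set.range fun n => u n / (n : ℝ)) := by
    refine ⟨min 0 (-Real.log B), ?_⟩
    rintro _ ⟨n, rfl⟩
    rcases Nat.eq_zero_or_pos n with rfl | hn
    · simp
    · have hn' : (0 : ℝ) < n := by exact_mod_cast hn
      refine (min_le_right _ _).trans ?_
      show _ ≤ u n / (n : ℝ)
      rw [le_div_iff₀ hn']
      have h1 := Real.log_nonneg (hlow n)
      rw [Real.log_mul (by positivity) (hpos n).ne', Real.log_pow] at h1
      simp only [hu]
      linarith
  have hlim := hsub.tendsto_lim hbdd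
  have hupper : Tendsto (fun n : ℕ => Real.log C / n + Real.log t) atTop
      (nhds (0 + Real.log t)) :=
    (tendsto_const_div_atTop_nhds_zero_nat _).add_const _
  have hle' : hsub.lim ≤ 0 + Real.log t := by
    refine le_of_tendsto_of_tendsto hlim hupper ?_
    filter_upwards [eventually_gt_atTop 0] with n hn
    have hn' : (0 : ℝ) < n := by exact_mod_cast hn
    have h1 := Real.log_le_log (hpos n) (hle n)
    rw [Real.log_mul hC.ne' (by positivity), Real.log_pow] at h1
    rw [div_add' _ _ _ hn'.ne']
    gcongr
    simp only [hu]
    linarith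
  refine ⟨Real.exp hsub.lim, ?_, ?_⟩
  · rw [Real.exp_lt_one_iff]
    have := Real.log_neg ht0 ht1
    linarith
  · refine ((Real.continuous_exp.tendsto _).comp hlim).congr fun n => ?_
    simp only [hu, Function.comp_apply]
    rw [Real.rpow_def_of_pos (hpos n)]
    congr 1
    ring

end Operators

section Scalars

/-- Uniform exponential decay of `a` in direction `s` from the indices in `S`. -/
def ExpDecay (a : ℤ → ℝ) (s : ℤ) (S : Set ℤ) : Prop :=
  ∃ D t : ℝ, 0 < D ∧ 0 < t ∧ t < 1 ∧ ∀ k ∈ S, ∀ n : ℕ, a (k + s * n) ≤ D * t ^ n * a k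

theorem ExpDecay.mono {a : ℤ → ℝ} {s : ℤ} {S S' : Set ℤ} (h : ExpDecay a s S) (hS : S' ⊆ S) :
    ExpDecay a s S' := by
  obtain ⟨D, t, hD, h0, h1, h⟩ := h
  exact ⟨D, t, hD, h0, h1, fun k hk => h k (hS hk)⟩

theorem le_pow_mul_add {a : ℤ → ℝ} {c : ℝ} (hc : 0 ≤ c) {s : ℤ}
    (h : ∀ k, a k ≤ c * a (k + s)) (k : ℤ) (n : ℕ) : a k ≤ c ^ n * a (k + s * n) := by
  induction n with
  | zero => simp
  | succ n ih =>
    refine ih.trans ?_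
    have h1 := h (k + s * n)
    calc c ^ n * a (k + s * n) ≤ c ^ n * (c * a (k + s * n + s)) :=
          mul_le_mul_of_nonneg_left h1 (by positivity)
      _ = _ := by rw [pow_succ, mul_assoc]; congr 3; push_cast; ring

theorem le_pow_natAbs_mul_add {a : ℤ → ℝ} {c : ℝ} (hc : 0 ≤ c)
    (h₁ : ∀ k, a k ≤ c * a (k + 1)) (h₂ : ∀ k, a k ≤ c * a (k - 1)) (k r : ℤ) :
    a k ≤ c ^ r.natAbs * a (k + r) := by
  rcases Int.natAbs_eq r with h | h
  · have := le_pow_mul_add hc (s := 1) h₁ k r.natAbs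
    rwa [one_mul, ← h] at this
  · have := le_pow_mul_add hc (s := -1) h₂ k r.natAbs
    rwa [neg_one_mul, ← h] at this

/-- Exponential decay along large steps extends to all steps. -/
theorem expDecay_of_eventually {a : ℤ → ℝ} {c : ℝ} (hc : 1 ≤ c) (ha : ∀ k, 0 < a k) {s : ℤ}
    (h : ∀ k, a (k + s) ≤ c * a k) {S : Set ℤ} {D t : ℝ} (hD : 0 < D) (ht0 : 0 < t)
    (ht1 : t < 1) {N : ℕ} (hN : ∀ n ≥ N, ∀ k ∈ S, a (k + s * n) ≤ D * t ^ n * a k) :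
    ExpDecay a s S := by
  refine ⟨max D (c ^ N / t ^ N), t, lt_max_of_lt_left hD, ht0, ht1, fun k hk n => ?_⟩
  have hak := (ha k).le
  rcases le_total N n with hn | hn
  · refine (hN n hn k hk).trans ?_
    gcongr
    exact le_max_left _ _
  · have h1 : a (k + s * n) ≤ c ^ n * a k := by
      have := le_pow_mul_add (a := a) (c := c) (s := -s) (by linarith)
        (fun k => by have := h (k + -s); rwa [neg_add_cancel_right] at this) (k + s * n) n
      rwa [show k + s * n + -s * n = k by ring] at this
    calc a (k + s * n) ≤ c ^ n * a k := h1
      _ ≤ c ^ N * a k := by gcongr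
      _ = c ^ N / t ^ N * t ^ N * a k := by field_simp
      _ ≤ c ^ N / t ^ N * t ^ n * a k := by
        have : t ^ N ≤ t ^ n := pow_le_pow_of_le_one ht0.le ht1.le hn
        gcongr
      _ ≤ _ := by gcongr; exact le_max_right _ _

theorem ExpDecay.translate {a : ℤ → ℝ} {c : ℝ} (hc : 1 ≤ c)
    (h₁ : ∀ k, a k ≤ c * a (k + 1)) (h₂ : ∀ k, a k ≤ c * a (k - 1)) {s : ℤ} {S S' : Set ℤ}
    (h : ExpDecay a s S) (r : ℤ) (hr : ∀ k ∈ S', k + r ∈ S) : ExpDecay a s S' := by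
  obtain ⟨D, t, hD, h0, h1, h⟩ := h
  have hc0 : 0 ≤ c := by linarith
  refine ⟨c ^ r.natAbs * D * c ^ r.natAbs, t, by positivity, h0, h1, fun k hk n => ?_⟩
  have e1 := le_pow_natAbs_mul_add hc0 h₁ h₂ (k + s * n) r
  have e2 := le_pow_natAbs_mul_add hc0 h₁ h₂ (k + r) (-r)
  have e3 := h (k + r) (hr k hk) n
  rw [Int.natAbs_neg, add_neg_cancel_right] at e2
  rw [add_right_comm] at e1
  calc _ ≤ _ := e1
    _ ≤ c ^ r.natAbs * (D * t ^ n * (c ^ r.natAbs * a k)) :=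
      mul_le_mul_of_nonneg_left (e3.trans (mul_le_mul_of_nonneg_left e2 (by positivity)))
        (by positivity)
    _ = _ := by ring

theorem ExpDecay.of_rpow {a : ℤ → ℝ} (ha : ∀ k, 0 < a k) {q : ℝ} (hq : 0 < q) {s : ℤ}
    {S : Set ℤ} (h : ExpDecay (fun k => a k ^ (1 / q)) s S) : ExpDecay a s S := by
  obtain ⟨D, t, hD, h0, h1, h⟩ := h
  refine ⟨D ^ q, t ^ q, by positivity, by positivity, Real.rpow_lt_one h0.le h1 hq,
    fun k hk n => ?_⟩
  have hk0 := (ha k).le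
  have h2 := Real.rpow_le_rpow (by have := ha (k + s * n); positivity) (h k hk n) hq.le
  have e : ∀ x : ℝ, 0 ≤ x → (x ^ (1 / q)) ^ q = x := fun x hx => by
    rw [← Real.rpow_mul hx, one_div, inv_mul_cancel₀ hq.ne', Real.rpow_one]
  rw [e _ (ha _).le, Real.mul_rpow (by positivity) (by positivity),
    Real.mul_rpow (by positivity) (by positivity), e _ hk0] at h2
  rwa [← Real.rpow_natCast, ← Real.rpow_mul h0.le, mul_comm q, Real.rpow_mul h0.le,
    Real.rpow_natCast]

theorem ExpDecay.reflect {a : ℤ → ℝ} {s : ℤ} {S : Set ℤ}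
    (h : ExpDecay (fun k => a (-k)) s S) : ExpDecay a (-s) {k | -k ∈ S} := by
  obtain ⟨D, t, hD, h0, h1, h⟩ := h
  refine ⟨D, t, hD, h0, h1, fun k hk n => ?_⟩
  have := h (-k) hk n
  simp only [neg_neg] at this
  rwa [show -(-k + s * n) = k + -s * n by ring] at this

/-- If `g` is the decrement of a sequence `v` bounded by a multiple of `g`, then `g⁻¹` decays
to the left on the set where `v` is positive. -/
theorem expDecay_inv_of_pos {g v : ℤ → ℝ} {c K : ℝ} (hg : ∀ k, 0 < g k) (hc : 1 ≤ c)
    (h₁ : ∀ k, g k ≤ c * g (k + 1)) (h₂ : ∀ k, g k ≤ c * g (k - 1)) (hK : 2 ≤ K)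
    (hv : ∀ k, |v k| ≤ K * g k) (hvg : ∀ k, v k - v (k + 1) = g k) {S : Set ℤ}
    (hS : ∀ k ∈ S, k - 1 ∈ S) (hpos : ∀ k ∈ S, 0 < v k) :
    ExpDecay (fun k => (g k)⁻¹) (-1) S := by
  have hK0 : 0 < K := by linarith
  set t := 1 - K⁻¹ with ht
  have hKi : K⁻¹ ≤ 1 / 2 := by rw [one_div]; exact inv_anti₀ (by norm_num) hK
  have hKi0 : 0 < K⁻¹ := by positivity
  have ht0 : 0 < t := by linarith
  have hstep : ∀ k ∈ S, v k ≤ t * v (k + -1) := fun k hk => by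
    have e1 := hvg (k - 1)
    rw [sub_add_cancel] at e1
    have e2 := (le_abs_self _).trans (hv (k - 1))
    have e3 : K⁻¹ * v (k - 1) ≤ g (k - 1) := by
      rw [inv_mul_le_iff₀ hK0]; exact e2
    rw [← sub_eq_add_neg, ht]
    linarith
  have hpow : ∀ n : ℕ, ∀ k ∈ S, v k ≤ t ^ n * v (k - n) ∧ k - n ∈ S := fun n => by
    induction n with
    | zero => intro k hk; simpa using hk
    | succ n ih =>
      intro k hk
      obtain ⟨i1, i2⟩ := ih k hk
      have e : k - ((n + 1 : ℕ) : ℤ) = k - n - 1 := by push_cast; ring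
      rw [e]
      refine ⟨i1.trans ?_, hS _ i2⟩
      rw [pow_succ, mul_assoc]
      exact mul_le_mul_of_nonneg_left (hstep _ i2) (by positivity)
  refine ⟨K * c * c, t, by positivity, ht0, by linarith, fun k hk n => ?_⟩
  have e1 : g k ≤ K * c * c * t ^ n * g (k + -1 * n) := by
    have i1 := (hpow n (k - 1) (hS k hk)).1
    have i2 := hvg (k - 1)
    rw [sub_add_cancel] at i2
    have i3 := hpos k hk
    have i4 := (le_abs_self _).trans (hv (k - 1 - n))
    have i5 := h₁ (k - 1 - n)
    rw [show k - 1 - n + 1 = k + -1 * n by ring] at i5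
    calc g k ≤ c * g (k - 1) := h₂ k
      _ ≤ c * v (k - 1) := by gcongr; linarith
      _ ≤ c * (t ^ n * (K * (c * g (k + -1 * n)))) := by
        gcongr
        refine i1.trans ?_
        gcongr
        refine i4.trans ?_
        gcongr
      _ = _ := by ring
  have hgk := hg k
  have hgn := hg (k + -1 * n)
  rw [inv_le_iff_one_le_mul₀ hgn]
  have : 1 ≤ (K * c * c * t ^ n * g (k + -1 * n)) / g k := (one_le_div hgk).2 e1
  calc 1 ≤ _ := this
    _ = _ := by field_simp

/-- If `g` is the decrement of a sequence bounded by a multiple of `g`, then `g⁻¹` decays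
exponentially to the left, to the right, or at both ends. -/
theorem expDecay_trichotomy {g v : ℤ → ℝ} {c K : ℝ} (hg : ∀ k, 0 < g k) (hc : 1 ≤ c)
    (h₁ : ∀ k, g k ≤ c * g (k + 1)) (h₂ : ∀ k, g k ≤ c * g (k - 1)) (hK : 2 ≤ K)
    (hv : ∀ k, |v k| ≤ K * g k) (hvg : ∀ k, v k - v (k + 1) = g k) :
    ExpDecay (fun k => (g k)⁻¹) (-1) univ ∨ ExpDecay (fun k => (g k)⁻¹) 1 univ ∨
      (ExpDecay (fun k => (g k)⁻¹) (-1) (Iic 0) ∧ ExpDecay (fun k => (g k)⁻¹) 1 (Ici 0)) := by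
  have hanti : StrictAnti v := by
    refine strictAnti_int_of_succ_lt fun k => ?_
    have := hvg k
    have := hg k
    linarith
  have left : ∀ {S : Set ℤ}, (∀ k ∈ S, k - 1 ∈ S) → (∀ k ∈ S, 0 < v k) →
      ExpDecay (fun k => (g k)⁻¹) (-1) S := fun hS hp =>
    expDecay_inv_of_pos hg hc h₁ h₂ hK hv hvg hS hp
  have right : ∀ {S : Set ℤ}, (∀ k ∈ S, k + 1 ∈ S) → (∀ k ∈ S, v (k + 1) < 0) →
      ExpDecay (fun k => (g k)⁻¹) 1 S := fun {S} hS hn => by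
    have h := expDecay_inv_of_pos (g := fun k => g (-k)) (v := fun k => -v (-k + 1))
      (c := c) (K := K * c) (S := {k | -k ∈ S}) (fun k => hg _) hc
      (fun k => by have := h₂ (-k); rwa [show -k - 1 = -(k + 1) by ring] at this)
      (fun k => by have := h₁ (-k); rwa [show -k + 1 = -(k - 1) by ring] at this)
      (by nlinarith)
      (fun k => by
        rw [abs_neg, mul_assoc]
        refine (hv _).trans ?_
        have := h₂ (-k + 1)
        rw [add_sub_cancel_right] at this
        gcongr)
      (fun k => by
        have := hvg (-k)
        rw [show -(k + 1) + 1 = -k by ring]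
        linarith)
      (fun k hk => by
        have := hS _ hk
        rwa [show -k + 1 = -(k - 1) by ring] at this)
      (fun k hk => by
        have := hn _ hk
        linarith)
    have h' := ExpDecay.reflect (a := fun k => (g k)⁻¹) h
    simpa using h'
  by_cases hp : ∀ k, 0 < v k
  · exact Or.inl (left (fun _ _ => trivial) fun k _ => hp k)
  by_cases hn : ∀ k, v k < 0
  · exact Or.inr (Or.inl (right (fun _ _ => trivial) fun k _ => hn _))
  push Not at hp hn
  obtain ⟨k₀, hk₀⟩ := hp
  obtain ⟨k₁, hk₁⟩ := hn
  have hi : ∀ {x y : ℝ}, 0 < x → 0 < y → x ≤ c * y → y⁻¹ ≤ c * x⁻¹ := fun hx hy hxy => by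
    rw [← div_eq_mul_inv, le_div_iff₀ hx, inv_mul_le_iff₀ hy, mul_comm]
    exact hxy
  have hi₁ : ∀ k, (g k)⁻¹ ≤ c * (g (k + 1))⁻¹ := fun k =>
    hi (hg _) (hg _) (by have := h₂ (k + 1); rwa [add_sub_cancel_right] at this)
  have hi₂ : ∀ k, (g k)⁻¹ ≤ c * (g (k - 1))⁻¹ := fun k =>
    hi (hg _) (hg _) (by have := h₁ (k - 1); rwa [sub_add_cancel] at this)
  refine Or.inr (Or.inr ⟨?_, ?_⟩)
  · refine (left (S := Iio k₁) (fun k hk => ?_) fun k hk => ?_).translate hc hi₁ hi₂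
      (k₁ - 1) fun k hk => ?_
    · simp only [mem_Iio] at *; omega
    · exact hk₁.trans_lt (hanti hk)
    · simp only [mem_Iio, mem_Iic] at *; omega
  · refine (right (S := Ici k₀) (fun k hk => ?_) fun k hk => ?_).translate hc hi₁ hi₂
      k₀ fun k hk => ?_
    · simp only [mem_Ici] at *; omega
    · exact (hanti (by simp only [mem_Ici] at hk; omega)).trans_le hk₀
    · simp only [mem_Ici] at *; omega

end Scalars

section RootTest

theorem rootBound_iff_expDecay {ι : Type*} {a x y : ℤ → ℝ} {C c : ℝ} (hC : 1 ≤ C) (hc : 1 ≤ c)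
    (ha : ∀ k, 0 < a k) (hx₁ : ∀ k, a k ≤ x k) (hx₂ : ∀ k, x k ≤ C * a k)
    (hy₁ : ∀ k, a k ≤ y k) (hy₂ : ∀ k, y k ≤ C * a k) {s : ℤ} (h : ∀ k, a (k + s) ≤ c * a k)
    {S : Set ℤ} {σ τ : ι → ℕ → ℤ} (hστ : ∀ i n, σ i n = τ i n + s * n)
    (hτS : ∀ i n, τ i n ∈ S) (hSτ : ∀ n, ∀ k ∈ S, ∃ i, τ i n = k) :
    (∃ D t : ℝ, 0 < D ∧ 0 < t ∧ t < 1 ∧ ∃ N : ℕ, ∀ n ≥ N, ∀ i,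
        x (σ i n) ≤ D * t ^ n * y (τ i n)) ↔ ExpDecay a s S := by
  constructor
  · rintro ⟨D, t, hD, ht0, ht1, N, hN⟩
    refine expDecay_of_eventually hc ha h (D := D * C) (by positivity) ht0 ht1 (N := N)
      fun n hn k hk => ?_
    obtain ⟨i, rfl⟩ := hSτ n k hk
    rw [← hστ]
    calc _ ≤ _ := hx₁ _
      _ ≤ _ := hN n hn i
      _ ≤ D * t ^ n * (C * a (τ i n)) := by gcongr; exact hy₂ _
      _ = _ := by ring
  · rintro ⟨D, t, hD, ht0, ht1, hd⟩
    refine ⟨C * D, t, by positivity, ht0, ht1, 0, fun n _ i => ?_⟩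
    calc _ ≤ _ := hx₂ _
      _ ≤ C * (D * t ^ n * a (τ i n)) := by
        gcongr
        rw [hστ]
        exact hd _ (hτS i n) n
      _ ≤ C * (D * t ^ n * y (τ i n)) := by gcongr; exact hy₁ _
      _ = _ := by ring

theorem limsup_iSup_rpow_lt_one_iff {ι : Type*} {u w : ℤ → ℝ≥0∞}
    (hut : ∀ k, u k ≠ ⊤) (hw0 : ∀ k, w k ≠ 0) (hwt : ∀ k, w k ≠ ⊤) (σ τ : ι → ℕ → ℤ) :
    limsup (fun n : ℕ => ⨆ i, (u (σ i n) / w (τ i n)) ^ (1 / (n : ℝ))) atTop < 1 ↔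
      ∃ D t : ℝ, 0 < D ∧ 0 < t ∧ t < 1 ∧ ∃ N : ℕ, ∀ n ≥ N, ∀ i,
        (u (σ i n)).toReal ≤ D * t ^ n * (w (τ i n)).toReal := by
  have hconv : ∀ {k l : ℤ} {r : ℝ}, 0 ≤ r →
      (u k / w l ≤ ENNReal.ofReal r ↔ (u k).toReal ≤ r * (w l).toReal) := fun {k l r} hr => by
    rw [ENNReal.div_le_iff (hw0 l) (hwt l),
      ← ENNReal.toReal_le_toReal (hut k) (ENNReal.mul_ne_top ENNReal.ofReal_ne_top (hwt l)),
      ENNReal.toReal_mul, ENNReal.toReal_ofReal hr]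
  constructor
  · intro h
    obtain ⟨b, hb, hb1⟩ := exists_between h
    have hbt : b ≠ ⊤ := (hb1.trans ENNReal.one_lt_top).ne
    have hb0 : b ≠ 0 := (pos_of_gt hb).ne'
    have hev := eventually_lt_of_limsup_lt hb
    obtain ⟨N, hN⟩ := eventually_atTop.1 (hev.and (eventually_gt_atTop 0))
    refine ⟨1, b.toReal, one_pos, ENNReal.toReal_pos hb0 hbt, ?_, N, fun n hn i => ?_⟩
    · rw [← ENNReal.toReal_one]
      exact (ENNReal.toReal_lt_toReal hbt ENNReal.one_ne_top).2 hb1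
    · obtain ⟨h1, h2⟩ := hN n hn
      have h2' : (0 : ℝ) < n := by exact_mod_cast h2
      rw [one_mul, ← hconv (by positivity), ENNReal.ofReal_pow ENNReal.toReal_nonneg,
        ENNReal.ofReal_toReal hbt]
      have h3 := (le_iSup (fun i => (u (σ i n) / w (τ i n)) ^ (1 / (n : ℝ))) i).trans h1.le
      rwa [one_div, ENNReal.rpow_inv_le_iff h2', ENNReal.rpow_natCast] at h3
  · rintro ⟨D, t, hD, ht0, ht1, N, hN⟩
    obtain ⟨r, hr, hr1⟩ := exists_between ht1
    have hr0 : 0 < r := ht0.trans hr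
    have hlim : Tendsto (fun n : ℕ => D * (t / r) ^ n) atTop (nhds (D * 0)) :=
      (tendsto_pow_atTop_nhds_zero_of_lt_one (by positivity) ((div_lt_one hr0).2 hr)).const_mul D
    rw [mul_zero] at hlim
    refine lt_of_le_of_lt (limsup_le_of_le (a := ENNReal.ofReal r) (by isBoundedDefault) ?_)
      (by rw [← ENNReal.ofReal_one]; exact (ENNReal.ofReal_lt_ofReal_iff one_pos).2 hr1)
    filter_upwards [eventually_ge_atTop N, eventually_gt_atTop 0,
      hlim.eventually (gt_mem_nhds one_pos)] with n hn hn0 hn1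
    have hn0' : (0 : ℝ) < n := by exact_mod_cast hn0
    refine iSup_le fun i => ?_
    rw [one_div, ENNReal.rpow_inv_le_iff hn0', ENNReal.rpow_natCast,
      ← ENNReal.ofReal_pow hr0.le, hconv (by positivity)]
    refine (hN n hn i).trans ?_
    gcongr
    calc D * t ^ n = D * (t / r) ^ n * r ^ n := by rw [div_pow]; field_simp
      _ ≤ 1 * r ^ n := by gcongr
      _ = r ^ n := one_mul _

theorem one_lt_liminf_iInf_rpow_iff {ι : Type*} {u w : ℤ → ℝ≥0∞}
    (hu0 : ∀ k, u k ≠ 0) (hut : ∀ k, u k ≠ ⊤) (hw0 : ∀ k, w k ≠ 0) (hwt : ∀ k, w k ≠ ⊤)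
    (σ τ : ι → ℕ → ℤ) :
    1 < liminf (fun n : ℕ => ⨅ i, (u (σ i n) / w (τ i n)) ^ (1 / (n : ℝ))) atTop ↔
      ∃ D t : ℝ, 0 < D ∧ 0 < t ∧ t < 1 ∧ ∃ N : ℕ, ∀ n ≥ N, ∀ i,
        (w (τ i n)).toReal ≤ D * t ^ n * (u (σ i n)).toReal := by
  rw [← limsup_iSup_rpow_lt_one_iff hwt hu0 hut τ σ, ← ENNReal.inv_lt_inv, inv_one,
    ENNReal.inv_liminf]
  simp_rw [ENNReal.inv_iInf, ← ENNReal.inv_rpow]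
  have : ∀ k l, (u k / w l)⁻¹ = w l / u k := fun k l =>
    ENNReal.inv_div (Or.inl (hwt l)) (Or.inl (hw0 l))
  simp_rw [this]

end RootTest

theorem img_eq_preimage {Y : Type*} (f : Equiv.Perm Y) (k : ℤ) (B : Set Y) :
    img f k B = ⇑(f ^ (-k)) ⁻¹' B := by
  rw [zpow_neg]
  exact Equiv.image_eq_preimage_symm _ _

theorem perm_zpow_add_apply {Y : Type*} (f : Equiv.Perm Y) (k l : ℤ) (x : Y) :
    (f ^ (k + l)) x = (f ^ k) ((f ^ l) x) := by
  rw [zpow_add]; rfl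

section Dissipative

variable {μ : Measure X} {f : Equiv.Perm X} {W : Set X}
  {p : ℝ≥0∞} [Fact (1 ≤ p)] {ρ : ℤ → X → ℝ≥0∞} {m M : ℤ → ℝ≥0∞}

theorem IsDissipative.measurable_zpow (hd : IsDissipative μ f W) (k : ℤ) :
    Measurable ⇑(f ^ k) := by
  induction k using Int.induction_on with
  | zero => exact measurable_id
  | succ i ih => rw [zpow_add, zpow_one]; exact ih.comp hd.meas_f
  | pred i ih => rw [zpow_sub, zpow_one]; exact ih.comp hd.meas_symm

theorem IsDissipative.measurableSet_img (hd : IsDissipative μ f W) (k : ℤ) {B : Set X}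
    (hB : MeasurableSet B) : MeasurableSet (img f k B) := by
  rw [img_eq_preimage]
  exact hd.measurable_zpow _ hB

theorem quasiMeasurePreserving_zpow (hd : IsDissipative μ f W)
    (hρ : ∀ k : ℤ, ∀ B : Set X, MeasurableSet B → μ (img f k B) = ∫⁻ x in B, ρ k x ∂μ) (n : ℤ) :
    Measure.QuasiMeasurePreserving ⇑(f ^ n) μ μ := by
  refine ⟨hd.measurable_zpow n, Measure.AbsolutelyContinuous.mk fun B hB h0 => ?_⟩
  rw [Measure.map_apply (hd.measurable_zpow n) hB]
  have := hρ (-n) B hB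
  rw [img_eq_preimage, neg_neg] at this
  rw [this, Measure.restrict_eq_zero.2 h0, lintegral_zero_measure]

theorem setLIntegral_img (hd : IsDissipative μ f W) (hρmeas : ∀ k : ℤ, Measurable (ρ k))
    (hρ : ∀ k : ℤ, ∀ B : Set X, MeasurableSet B → μ (img f k B) = ∫⁻ x in B, ρ k x ∂μ)
    (k : ℤ) {G : X → ℝ≥0∞} (hG : Measurable G) :
    ∫⁻ x in img f k W, G x ∂μ = ∫⁻ x in W, ρ k x * G ((f ^ k) x) ∂μ := by
  have hmap : μ.map ⇑(f ^ (-k)) = μ.withDensity (ρ k) := by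
    ext B hB
    rw [Measure.map_apply (hd.measurable_zpow _) hB, withDensity_apply _ hB, ← hρ k B hB,
      img_eq_preimage]
  have hGk : Measurable fun x => G ((f ^ k) x) := hG.comp (hd.measurable_zpow k)
  have h1 := setLIntegral_withDensity_eq_setLIntegral_mul μ (hρmeas k) hGk hd.meas_W
  simp only [Pi.mul_apply] at h1
  rw [← h1, ← hmap, setLIntegral_map hd.meas_W hGk (hd.measurable_zpow _), ← img_eq_preimage]
  refine lintegral_congr fun x => ?_
  rw [← perm_zpow_add_apply, add_neg_cancel]
  rfl

theorem lintegral_eq_tsum (hd : IsDissipative μ f W) (hρmeas : ∀ k : ℤ, Measurable (ρ k))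
    (hρ : ∀ k : ℤ, ∀ B : Set X, MeasurableSet B → μ (img f k B) = ∫⁻ x in B, ρ k x ∂μ)
    {G : X → ℝ≥0∞} (hG : Measurable G) :
    ∫⁻ x, G x ∂μ = ∑' k : ℤ, ∫⁻ x in W, ρ k x * G ((f ^ k) x) ∂μ := by
  rw [← setLIntegral_univ, ← hd.cover,
    lintegral_iUnion (fun k => hd.measurableSet_img k hd.meas_W) hd.disj]
  exact tsum_congr fun k => setLIntegral_img hd hρmeas hρ k hG

theorem lintegral_comp_zpow_le (hd : IsDissipative μ f W) (hρmeas : ∀ k : ℤ, Measurable (ρ k))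
    (hρ : ∀ k : ℤ, ∀ B : Set X, MeasurableSet B → μ (img f k B) = ∫⁻ x in B, ρ k x ∂μ)
    (hm : ∀ k, ∀ᵐ x ∂μ.restrict W, m k ≤ ρ k x) (hM : ∀ k, ∀ᵐ x ∂μ.restrict W, ρ k x ≤ M k)
    {S : Set ℤ} {κ : ℝ≥0∞} (n : ℤ) (hκ : ∀ j ∈ S, M (j - n) ≤ κ * m j)
    {G : X → ℝ≥0∞} (hG : Measurable G) (hGS : ∀ j ∉ S, ∀ x ∈ img f j W, G x = 0) :
    ∫⁻ x, G ((f ^ n) x) ∂μ ≤ κ * ∫⁻ x, G x ∂μ := by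
  have hGn : Measurable fun x => G ((f ^ n) x) := hG.comp (hd.measurable_zpow n)
  rw [lintegral_eq_tsum hd hρmeas hρ hG, lintegral_eq_tsum hd hρmeas hρ hGn,
    ← ENNReal.tsum_mul_left, ← (Equiv.subRight n).tsum_eq]
  refine ENNReal.tsum_le_tsum fun j => ?_
  simp only [Equiv.subRight_apply]
  rw [← lintegral_const_mul _ (show Measurable fun x => ρ j x * G ((f ^ j) x) from
    (hρmeas j).mul (hG.comp (hd.measurable_zpow j)))]
  refine lintegral_mono_ae ?_
  filter_upwards [hm j, hM (j - n), ae_restrict_mem hd.meas_W] with x h1 h2 hxW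
  rw [← perm_zpow_add_apply, add_sub_cancel, ← mul_assoc]
  by_cases hj : j ∈ S
  · gcongr
    exact h2.trans ((hκ j hj).trans (by gcongr))
  · rw [hGS j hj _ ⟨x, hxW, rfl⟩, mul_zero, mul_zero]

theorem RepsComp.zpow_ae_eq {T : Lp ℝ p μ ≃L[ℝ] Lp ℝ p μ} (hT : RepsComp μ p f T)
    (hq : ∀ n : ℤ, Measure.QuasiMeasurePreserving ⇑(f ^ n) μ μ) (n : ℤ) (φ : Lp ℝ p μ) :
    ⇑((T ^ n) φ) =ᵐ[μ] fun x => φ ((f ^ n) x) := by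
  have hinv : ∀ ψ : Lp ℝ p μ, ⇑(T.symm ψ) =ᵐ[μ] fun x => ψ ((f ^ (-1 : ℤ)) x) := fun ψ => by
    have h1 := hT (T.symm ψ)
    rw [T.apply_symm_apply] at h1
    filter_upwards [(hq (-1)).ae h1] with x hx
    rw [hx, zpow_neg_one]
    simp
  induction n using Int.induction_on with
  | zero => exact ae_of_all _ fun x => rfl
  | succ i ih =>
    rw [zpow_add_one_apply]
    have h1 := (hq 1).ae ih
    filter_upwards [hT ((T ^ (i : ℤ)) φ), h1] with x hx h1
    rw [hx, perm_zpow_add_apply, ← h1, zpow_one]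
  | pred i ih =>
    have e : (T ^ (-(i : ℤ) - 1)) φ = T.symm ((T ^ (-(i : ℤ))) φ) := by
      rw [T.eq_symm_apply, ← zpow_add_one_apply, sub_add_cancel]
    rw [e]
    have h1 := (hq (-1)).ae ih
    filter_upwards [hinv ((T ^ (-(i : ℤ))) φ), h1] with x hx h1
    rw [hx, h1, sub_eq_add_neg, perm_zpow_add_apply]

theorem norm_le_of_lintegral_le (hp : p ≠ ⊤) {φ ψ : Lp ℝ p μ} {κ : ℝ} (hκ : 0 ≤ κ)
    (h : ∫⁻ x, ‖ψ x‖ₑ ^ p.toReal ∂μ ≤ ENNReal.ofReal κ * ∫⁻ x, ‖φ x‖ₑ ^ p.toReal ∂μ) :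
    ‖ψ‖ ≤ κ ^ (1 / p.toReal) * ‖φ‖ := by
  have hp1 : 1 ≤ p := Fact.out
  have hp0 : p ≠ 0 := (zero_lt_one.trans_le hp1).ne'
  have hq : 0 < p.toReal := ENNReal.toReal_pos hp0 hp
  have h1 : eLpNorm ψ p μ ≤ ENNReal.ofReal κ ^ (1 / p.toReal) * eLpNorm φ p μ := by
    rw [eLpNorm_eq_lintegral_rpow_enorm_toReal hp0 hp,
      eLpNorm_eq_lintegral_rpow_enorm_toReal hp0 hp,
      ← ENNReal.mul_rpow_of_nonneg _ _ (by positivity)]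
    gcongr
  rw [ENNReal.ofReal_rpow_of_nonneg hκ (by positivity)] at h1
  rw [Lp.norm_def, Lp.norm_def]
  have h2 := ENNReal.toReal_mono
    (ENNReal.mul_ne_top ENNReal.ofReal_ne_top (Lp.memLp φ).eLpNorm_ne_top) h1
  rwa [ENNReal.toReal_mul, ENNReal.toReal_ofReal (by positivity)] at h2

/-- If the weights decay exponentially from the indices in `S`, the corresponding power of the
composition operator contracts the functions supported on the levels indexed by `S`. -/
theorem contractsOn_of_expDecay (hp : p ≠ ⊤) (hd : IsDissipative μ f W)
    (hρmeas : ∀ k : ℤ, Measurable (ρ k))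
    (hρ : ∀ k : ℤ, ∀ B : Set X, MeasurableSet B → μ (img f k B) = ∫⁻ x in B, ρ k x ∂μ)
    (hm : ∀ k, ∀ᵐ x ∂μ.restrict W, m k ≤ ρ k x) (hM : ∀ k, ∀ᵐ x ∂μ.restrict W, ρ k x ≤ M k)
    (hmt : ∀ k, m k ≠ ⊤) {C : ℝ} (hC : 1 ≤ C)
    (hMC : ∀ k, M k ≤ ENNReal.ofReal C * m k) {s : ℤ} {S : Set ℤ}
    (hS : ExpDecay (fun k => (m k).toReal) s S) {U : Lp ℝ p μ ≃L[ℝ] Lp ℝ p μ}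
    (hU : ∀ (n : ℕ) (φ : Lp ℝ p μ), ⇑((U ^ n) φ) =ᵐ[μ] fun x => φ ((f ^ (-(s * n))) x))
    {N : Submodule ℝ (Lp ℝ p μ)}
    (hN : ∀ φ ∈ N, ∀ᵐ x ∂μ, x ∉ (⋃ j ∈ S, img f j W) → φ x = 0) : ContractsOn U N := by
  obtain ⟨D, t, hD, ht0, ht1, hdec⟩ := hS
  have hp1 : 1 ≤ p := Fact.out
  have hq : 0 < p.toReal := ENNReal.toReal_pos (zero_lt_one.trans_le hp1).ne' hp
  refine ⟨(C * D) ^ (1 / p.toReal), by positivity, t ^ (1 / p.toReal), by positivity,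
    Real.rpow_lt_one ht0.le ht1 (by positivity), fun n φ hφ => ?_⟩
  set A := ⋃ j ∈ S, img f j W with hA
  have hAm : MeasurableSet A :=
    MeasurableSet.biUnion (to_countable S) fun j _ => hd.measurableSet_img j hd.meas_W
  set G : X → ℝ≥0∞ := A.indicator fun x => ‖φ x‖ₑ ^ p.toReal with hG
  have hGm : Measurable G :=
    ((Lp.stronglyMeasurable φ).measurable.enorm.pow_const _).indicator hAm
  have hGφ : (fun x => ‖φ x‖ₑ ^ p.toReal) =ᵐ[μ] G := by
    filter_upwards [hN φ hφ] with x hx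
    by_cases hxA : x ∈ A
    · simp [hG, hxA]
    · simp [hG, hxA, hx hxA, hq]
  have hqn := quasiMeasurePreserving_zpow hd hρ (-(s * n))
  have key := lintegral_comp_zpow_le hd hρmeas hρ hm hM (S := S)
    (κ := ENNReal.ofReal (C * D * t ^ n)) (-(s * n)) (fun j hj => by
      rw [sub_neg_eq_add]
      refine (hMC _).trans ?_
      rw [mul_assoc C, ENNReal.ofReal_mul (by linarith), mul_assoc]
      gcongr
      rw [← ENNReal.ofReal_toReal (hmt (j + s * n)), ← ENNReal.ofReal_toReal (hmt j),
        ← ENNReal.ofReal_mul (by positivity)]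
      exact ENNReal.ofReal_le_ofReal (hdec j hj n)) hGm (fun j hj x hx => by
      refine indicator_of_notMem (fun hxA => ?_) _
      obtain ⟨i, hi, hxi⟩ := mem_iUnion₂.1 hxA
      have hij : i ≠ j := fun h => hj (h ▸ hi)
      exact (disjoint_left.1 (hd.disj hij)) hxi hx)
  have h1 : ‖(U ^ n) φ‖ ≤ (C * D * t ^ n) ^ (1 / p.toReal) * ‖φ‖ := by
    refine norm_le_of_lintegral_le hp (by positivity) ?_
    rw [lintegral_congr_ae hGφ]
    refine le_trans (le_of_eq (lintegral_congr_ae ?_)) key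
    filter_upwards [hU n φ, hqn.ae hGφ] with x h1 h2
    rw [h1, ← h2]
  refine h1.trans (le_of_eq ?_)
  rw [Real.mul_rpow (by positivity) (by positivity), ← Real.rpow_natCast, ← Real.rpow_natCast,
    ← Real.rpow_mul ht0.le, ← Real.rpow_mul ht0.le, mul_comm (n : ℝ)]

/-- The functions in `L^p` vanishing almost everywhere on `A`. -/
def vanishingOn (μ : Measure X) (p : ℝ≥0∞) [Fact (1 ≤ p)] (A : Set X) :
    Submodule ℝ (Lp ℝ p μ) :=
  LinearMap.ker (LpToLpRestrictCLM X ℝ ℝ μ p A : Lp ℝ p μ →ₗ[ℝ] Lp ℝ p (μ.restrict A))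

theorem isClosed_vanishingOn (A : Set X) : IsClosed (vanishingOn μ p A : Set (Lp ℝ p μ)) :=
  (LpToLpRestrictCLM X ℝ ℝ μ p A).isClosed_ker

theorem mem_vanishingOn {A : Set X} (hA : MeasurableSet A) {φ : Lp ℝ p μ} :
    φ ∈ vanishingOn μ p A ↔ ∀ᵐ x ∂μ, x ∈ A → φ x = 0 := by
  rw [← ae_restrict_iff' hA]
  have h1 := LpToLpRestrictCLM_coeFn ℝ (p := p) (μ := μ) A φ
  change LpToLpRestrictCLM X ℝ ℝ μ p A φ = 0 ↔ _
  rw [Lp.eq_zero_iff_ae_eq_zero]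
  constructor
  · intro h
    filter_upwards [h, h1] with x h h1
    rw [← h1, h]; rfl
  · intro h
    filter_upwards [h, h1] with x h h1
    rw [h1, h]; rfl

theorem isCompl_vanishingOn {A : Set X} (hA : MeasurableSet A) :
    IsCompl (vanishingOn μ p Aᶜ) (vanishingOn μ p A) := by
  constructor
  · rw [Submodule.disjoint_def]
    intro φ h1 h2
    rw [mem_vanishingOn hA.compl] at h1
    rw [mem_vanishingOn hA] at h2
    rw [Lp.eq_zero_iff_ae_eq_zero]
    filter_upwards [h1, h2] with x h1 h2
    by_cases hx : x ∈ A
    · exact h2 hx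
    · exact h1 hx
  · rw [codisjoint_iff, eq_top_iff]
    intro φ _
    obtain ⟨φ₁, h₁⟩ : ∃ ψ : Lp ℝ p μ, ψ =ᵐ[μ] A.indicator φ :=
      ⟨((Lp.memLp φ).indicator hA).toLp _, MemLp.coeFn_toLp _⟩
    obtain ⟨φ₂, h₂⟩ : ∃ ψ : Lp ℝ p μ, ψ =ᵐ[μ] Aᶜ.indicator φ :=
      ⟨((Lp.memLp φ).indicator hA.compl).toLp _, MemLp.coeFn_toLp _⟩
    have e : φ = φ₁ + φ₂ := by
      refine Lp.ext ?_
      filter_upwards [Lp.coeFn_add φ₁ φ₂, h₁, h₂] with x h h₁ h₂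
      rw [h, Pi.add_apply, h₁, h₂]
      exact (congrFun (Set.indicator_self_add_compl A (φ : X → ℝ)) x).symm
    rw [e]
    refine Submodule.add_mem_sup ?_ ?_
    · rw [mem_vanishingOn hA.compl]
      filter_upwards [h₁] with x hx hxA
      rw [hx, indicator_of_notMem hxA]
    · rw [mem_vanishingOn hA]
      filter_upwards [h₂] with x hx hxA
      rw [hx, indicator_of_notMem (not_not.2 hxA)]

end Dissipative

section Necessity

theorem exists_int_primitive {E : Type*} [AddCommGroup E] (z : ℤ → E) :
    ∃ y : ℤ → E, ∀ n, y (n + 1) = y n + z n := by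
  refine ⟨fun n => ∑ i ∈ Finset.range n.toNat, z i
    - ∑ i ∈ Finset.range (-n).toNat, z (-i - 1), fun n => ?_⟩
  rcases n with n | n
  · have h1 : (Int.ofNat n + 1).toNat = n + 1 := by simp
    have h2 : (-(Int.ofNat n + 1)).toNat = 0 := by omega
    have h3 : (Int.ofNat n).toNat = n := by simp
    have h4 : (-(Int.ofNat n)).toNat = 0 := by simp
    simp only [h1, h2, h3, h4, Finset.sum_range_succ]
    simp
  · have h1 : (Int.negSucc n + 1).toNat = 0 := by omega
    have h2 : (-(Int.negSucc n + 1)).toNat = n := by omega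
    have h3 : (Int.negSucc n).toNat = 0 := by omega
    have h4 : (-(Int.negSucc n)).toNat = n + 1 := by omega
    simp only [h1, h2, h3, h4, Finset.sum_range_succ]
    have : Int.negSucc n = -(n : ℤ) - 1 := by omega
    rw [this]
    simp

theorem exists_forced_orbit {E : Type*} [NormedAddCommGroup E] [NormedSpace ℝ E]
    (T : E ≃L[ℝ] E) (z : ℤ → E) : ∃ x : ℤ → E, ∀ n, x (n + 1) = T (x n) + z n := by
  obtain ⟨y, hy⟩ := exists_int_primitive fun n => (T ^ (-(n + 1))) (z n)
  refine ⟨fun n => (T ^ n) (y n), fun n => ?_⟩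
  simp only
  rw [hy, map_add, ← zpow_add_apply, add_neg_cancel, zpow_add_one_apply]
  rfl

/-- Shadowing yields a bounded solution of the inhomogeneous recursion for bounded forcing. -/
theorem HasShadowing.exists_bounded_solution {E : Type*} [NormedAddCommGroup E]
    [NormedSpace ℝ E] {T : E ≃L[ℝ] E} (h : HasShadowing T) {z : ℤ → E} {B : ℝ}
    (hz : ∀ n, ‖z n‖ ≤ B) :
    ∃ (d : ℤ → E) (R : ℝ), (∀ n, d (n + 1) = T (d n) + z n) ∧ ∀ n, ‖d n‖ ≤ R := by
  obtain ⟨δ, hδ, hs⟩ := h 1 one_pos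
  set B' := max B 1 with hB'
  have hB'0 : 0 < B' := lt_max_of_lt_right one_pos
  obtain ⟨x, hx⟩ := exists_forced_orbit T fun n => (δ / B') • z n
  obtain ⟨y, hy⟩ := hs x fun n => by
    rw [hx, sub_add_cancel_left, norm_neg, norm_smul, Real.norm_of_nonneg (by positivity)]
    calc δ / B' * ‖z n‖ ≤ δ / B' * B' := by
          gcongr
          exact (hz n).trans (le_max_left _ _)
      _ = δ := by field_simp
  refine ⟨fun n => (B' / δ) • (x n - (T ^ n) y), B' / δ, fun n => ?_, fun n => ?_⟩
  · simp only
    rw [hx, zpow_add_one_apply, map_smul, map_sub, add_sub_right_comm, smul_add, smul_smul]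
    congr 1
    rw [show B' / δ * (δ / B') = 1 by field_simp, one_smul]
  · rw [norm_smul, Real.norm_of_nonneg (by positivity), norm_sub_rev]
    exact mul_le_of_le_one_right (by positivity) (hy n).le

variable {μ : Measure X} {f : Equiv.Perm X} {W : Set X}
  {p : ℝ≥0∞} [Fact (1 ≤ p)] {ρ : ℤ → X → ℝ≥0∞} {m M : ℤ → ℝ≥0∞}

theorem Lp.integrableOn_of_measure_lt_top (hW : μ W < ⊤) (φ : Lp ℝ p μ) :
    IntegrableOn φ W μ := by
  have : Fact (μ W < ⊤) := ⟨hW⟩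
  exact ((Lp.memLp φ).restrict W).integrable Fact.out

theorem abs_setIntegral_zpow_le (hp : p ≠ ⊤) (hd : IsDissipative μ f W)
    (hρmeas : ∀ k : ℤ, Measurable (ρ k))
    (hρ : ∀ k : ℤ, ∀ B : Set X, MeasurableSet B → μ (img f k B) = ∫⁻ x in B, ρ k x ∂μ)
    (hm : ∀ k, ∀ᵐ x ∂μ.restrict W, m k ≤ ρ k x) (hm0 : ∀ k, m k ≠ 0) (hmt : ∀ k, m k ≠ ⊤)
    {T : Lp ℝ p μ ≃L[ℝ] Lp ℝ p μ} (hT : RepsComp μ p f T) (k : ℤ) (φ : Lp ℝ p μ) :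
    |∫ x in W, ((T ^ k) φ) x ∂μ| ≤
      (μ W ^ (1 - 1 / p.toReal)).toReal * (((m k).toReal ^ (1 / p.toReal))⁻¹ * ‖φ‖) := by
  have hp1 : 1 ≤ p := Fact.out
  have hp0 : p ≠ 0 := (zero_lt_one.trans_le hp1).ne'
  have hq : 0 < p.toReal := ENNReal.toReal_pos hp0 hp
  have hq1 : 1 ≤ p.toReal := by
    rw [← ENNReal.toReal_one]; exact ENNReal.toReal_mono hp hp1
  have hTk := hT.zpow_ae_eq (quasiMeasurePreserving_zpow hd hρ) k φ
  set ψ := (T ^ k) φ with hψ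
  have hG : Measurable fun x => ‖φ x‖ₑ ^ p.toReal :=
    (Lp.stronglyMeasurable φ).measurable.enorm.pow_const _
  have h1 : ∫⁻ x in W, ‖ψ x‖ₑ ^ p.toReal ∂μ ≤ (m k)⁻¹ * ∫⁻ x, ‖φ x‖ₑ ^ p.toReal ∂μ := by
    calc ∫⁻ x in W, ‖ψ x‖ₑ ^ p.toReal ∂μ
        ≤ ∫⁻ x in W, (m k)⁻¹ * (ρ k x * ‖φ ((f ^ k) x)‖ₑ ^ p.toReal) ∂μ := by
          refine lintegral_mono_ae ?_
          filter_upwards [hm k, ae_restrict_of_ae hTk] with x hx hx'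
          rw [hx', ← mul_assoc]
          refine le_mul_of_one_le_left' ?_
          rw [← ENNReal.inv_mul_cancel (hm0 k) (hmt k)]
          gcongr
      _ = (m k)⁻¹ * ∫⁻ x in W, ρ k x * ‖φ ((f ^ k) x)‖ₑ ^ p.toReal ∂μ :=
          lintegral_const_mul _ ((hρmeas k).mul (hG.comp (hd.measurable_zpow k)))
      _ = (m k)⁻¹ * ∫⁻ x in img f k W, ‖φ x‖ₑ ^ p.toReal ∂μ := by
          rw [setLIntegral_img hd hρmeas hρ k hG]
      _ ≤ _ := by
          gcongr
          exact Measure.restrict_le_self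
  have h2 : eLpNorm ψ p (μ.restrict W) ≤ (m k)⁻¹ ^ (1 / p.toReal) * eLpNorm φ p μ := by
    rw [eLpNorm_eq_lintegral_rpow_enorm_toReal hp0 hp,
      eLpNorm_eq_lintegral_rpow_enorm_toReal hp0 hp,
      ← ENNReal.mul_rpow_of_nonneg _ _ (by positivity)]
    gcongr
  have h3 := eLpNorm_le_eLpNorm_mul_rpow_measure_univ hp1
    (Lp.aestronglyMeasurable ψ).restrict (μ := μ.restrict W)
  rw [Measure.restrict_apply_univ, ENNReal.toReal_one, one_div_one, eLpNorm_one_eq_lintegral_enorm]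
    at h3
  have h4 := (enorm_integral_le_lintegral_enorm (μ := μ.restrict W) ψ).trans
    (h3.trans (mul_le_mul_left h2 _))
  have hfin : (m k)⁻¹ ^ (1 / p.toReal) * eLpNorm φ p μ * μ W ^ (1 - 1 / p.toReal) ≠ ⊤ := by
    refine ENNReal.mul_ne_top (ENNReal.mul_ne_top ?_ (Lp.memLp φ).eLpNorm_ne_top) ?_
    · exact ENNReal.rpow_ne_top_of_nonneg (by positivity) (ENNReal.inv_ne_top.2 (hm0 k))
    · refine ENNReal.rpow_ne_top_of_nonneg ?_ hd.fin.ne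
      rw [sub_nonneg]
      exact div_le_one_of_le₀ hq1 hq.le
  have h5 := ENNReal.toReal_mono hfin h4
  rw [toReal_enorm, Real.norm_eq_abs] at h5
  refine h5.trans (le_of_eq ?_)
  rw [ENNReal.toReal_mul, ENNReal.toReal_mul, ← ENNReal.toReal_rpow (m k)⁻¹, ENNReal.toReal_inv,
    Real.inv_rpow ENNReal.toReal_nonneg, Lp.norm_def]
  ring

theorem HasShadowing.expDecay (hp : p ≠ ⊤) (hd : IsDissipative μ f W)
    (hρmeas : ∀ k : ℤ, Measurable (ρ k))
    (hρ : ∀ k : ℤ, ∀ B : Set X, MeasurableSet B → μ (img f k B) = ∫⁻ x in B, ρ k x ∂μ)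
    (hm : ∀ k, ∀ᵐ x ∂μ.restrict W, m k ≤ ρ k x) (hM : ∀ k, ∀ᵐ x ∂μ.restrict W, ρ k x ≤ M k)
    (hm0 : ∀ k, m k ≠ 0) (hmt : ∀ k, m k ≠ ⊤) {C : ℝ} (hC : 1 ≤ C)
    (hMC : ∀ k, M k ≤ ENNReal.ofReal C * m k) {c : ℝ} (hc : 1 ≤ c)
    (h₁ : ∀ k, (m (k + 1)).toReal ≤ c * (m k).toReal)
    (h₂ : ∀ k, (m (k - 1)).toReal ≤ c * (m k).toReal)
    {T : Lp ℝ p μ ≃L[ℝ] Lp ℝ p μ} (hT : RepsComp μ p f T) (h : HasShadowing T) :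
    ExpDecay (fun k => (m k).toReal) (-1) univ ∨ ExpDecay (fun k => (m k).toReal) 1 univ ∨
      (ExpDecay (fun k => (m k).toReal) (-1) (Iic 0) ∧
        ExpDecay (fun k => (m k).toReal) 1 (Ici 0)) := by
  have hp1 : 1 ≤ p := Fact.out
  have hp0 : p ≠ 0 := (zero_lt_one.trans_le hp1).ne'
  have hq : 0 < p.toReal := ENNReal.toReal_pos hp0 hp
  set a : ℤ → ℝ := fun k => (m k).toReal with ha
  have ha0 : ∀ k, 0 < a k := fun k => ENNReal.toReal_pos (hm0 k) (hmt k)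
  set q := p.toReal with hqdef
  set g : ℤ → ℝ := fun k => (a k ^ (1 / q))⁻¹ with hg
  have har0 : ∀ k, 0 < a k ^ (1 / q) := fun k => Real.rpow_pos_of_pos (ha0 k) _
  have hg0 : ∀ k, 0 < g k := fun k => inv_pos.2 (har0 k)
  have hgd : ∀ k l, a l ≤ c * a k → g k ≤ c ^ (1 / q) * g l := fun k l hkl => by
    have e := Real.rpow_le_rpow (ha0 l).le hkl (by positivity : 0 ≤ 1 / q)
    rw [Real.mul_rpow (by linarith) (ha0 k).le] at e
    simp only [hg]
    rw [← div_eq_mul_inv, le_div_iff₀ (har0 l), inv_mul_le_iff₀ (har0 k), mul_comm]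
    exact e
  have hμ : ∀ k, μ (img f k W) ≤ ENNReal.ofReal C * m k * μ W := fun k => by
    rw [hρ k W hd.meas_W]
    calc ∫⁻ x in W, ρ k x ∂μ ≤ ∫⁻ _ in W, ENNReal.ofReal C * m k ∂μ := by
          refine lintegral_mono_ae ?_
          filter_upwards [hM k] with x hx
          exact hx.trans (hMC k)
      _ = _ := setLIntegral_const _ _
  have hfin : ∀ k, ENNReal.ofReal C * m k * μ W ≠ ⊤ := fun k =>
    ENNReal.mul_ne_top (ENNReal.mul_ne_top ENNReal.ofReal_ne_top (hmt k)) hd.fin.ne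
  have hμt : ∀ k, μ (img f k W) ≠ ⊤ := fun k => ne_top_of_le_ne_top (hfin k) (hμ k)
  set w := (μ W).toReal with hw
  have hw0 : 0 < w := ENNReal.toReal_pos hd.pos.ne' hd.fin.ne
  have hμr : ∀ k, μ.real (img f k W) ≤ C * a k * w := fun k => by
    have := ENNReal.toReal_mono (hfin k) (hμ k)
    rwa [ENNReal.toReal_mul, ENNReal.toReal_mul, ENNReal.toReal_ofReal (by linarith)] at this
  set χ : ℤ → Lp ℝ p μ := fun k =>
    indicatorConstLp p (hd.measurableSet_img k hd.meas_W) (hμt k) 1 with hχ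
  have hχT : ∀ k, ∫ x in W, ((T ^ k) (χ k)) x ∂μ = w := fun k => by
    have e : ∀ᵐ x ∂μ.restrict W, ((T ^ k) (χ k)) x = 1 := by
      have i1 := hT.zpow_ae_eq (quasiMeasurePreserving_zpow hd hρ) k (χ k)
      have i2 := (quasiMeasurePreserving_zpow hd hρ k).ae
        (indicatorConstLp_coeFn (p := p) (hs := hd.measurableSet_img k hd.meas_W)
          (hμs := hμt k) (c := (1 : ℝ)))
      filter_upwards [ae_restrict_of_ae i1, ae_restrict_of_ae i2,
        ae_restrict_mem hd.meas_W] with x i1 i2 hx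
      rw [i1]
      have hmem : (f ^ k) x ∈ img f k W := ⟨x, hx, rfl⟩
      exact i2.trans (indicator_of_mem hmem _)
    rw [integral_congr_ae e]
    simp [Measure.real, hw]
  obtain ⟨d, R, hdrec, hdR⟩ := h.exists_bounded_solution (B := (C * w) ^ (1 / q))
    (z := fun n => g (-n - 1) • χ (-n - 1)) fun n => by
      rw [norm_smul, Real.norm_of_nonneg (hg0 _).le, hχ, norm_indicatorConstLp hp0 hp, norm_one,
        one_mul]
      calc g (-n - 1) * μ.real (img f (-n - 1) W) ^ (1 / q)
          ≤ g (-n - 1) * (C * a (-n - 1) * w) ^ (1 / q) := by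
            have := (hg0 (-n - 1)).le
            gcongr
            exact hμr _
        _ = (C * w) ^ (1 / q) := by
            have i1 := (ha0 (-n - 1)).le
            have i2 := (har0 (-n - 1)).ne'
            rw [mul_right_comm, Real.mul_rpow (by positivity) i1]
            simp only [hg]
            field_simp
  set Bd := (μ W ^ (1 - 1 / q)).toReal with hBd
  have hBd0 : 0 ≤ Bd := ENNReal.toReal_nonneg
  set v : ℤ → ℝ := fun k => (∫ x in W, ((T ^ k) (d (-k))) x ∂μ) / w with hv
  have hvg : ∀ k, v k - v (k + 1) = g k := fun k => by
    have e1 : (T ^ k) (d (-k)) = (T ^ (k + 1)) (d (-(k + 1))) + g k • (T ^ k) (χ k) := by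
      have i1 := hdrec (-(k + 1))
      rw [show -(k + 1) + 1 = -k by ring] at i1
      rw [i1, map_add, map_smul, show -(-(k + 1)) - 1 = k by ring, zpow_add_apply, zpow_one]
    have e2 : ∫ x in W, ((T ^ k) (d (-k))) x ∂μ
        = ∫ x in W, ((T ^ (k + 1)) (d (-(k + 1)))) x ∂μ + g k * w := by
      rw [e1, ← hχT k, ← integral_const_mul,
        ← integral_add (Lp.integrableOn_of_measure_lt_top hd.fin _)
          ((Lp.integrableOn_of_measure_lt_top hd.fin _).const_mul _)]
      refine integral_congr_ae (ae_restrict_of_ae ?_)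
      filter_upwards [Lp.coeFn_add ((T ^ (k + 1)) (d (-(k + 1)))) (g k • (T ^ k) (χ k)),
        Lp.coeFn_smul (g k) ((T ^ k) (χ k))] with x h1 h2
      rw [h1, Pi.add_apply, h2]
      rfl
    simp only [hv]
    rw [e2]
    field_simp
    ring
  have hvb : ∀ k, |v k| ≤ max 2 (Bd * R / w) * g k := fun k => by
    have e := abs_setIntegral_zpow_le hp hd hρmeas hρ hm hm0 hmt hT k (d (-k))
    have e' : Bd * (g k * ‖d (-k)‖) ≤ Bd * (g k * R) := by
      have := (hg0 k).le
      gcongr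
      exact hdR _
    simp only [hv]
    rw [abs_div, abs_of_pos hw0]
    calc _ ≤ Bd * (g k * R) / w := by
          gcongr
          exact e.trans e'
      _ = Bd * R / w * g k := by ring
      _ ≤ _ := by
          have := (hg0 k).le
          gcongr
          exact le_max_right _ _
  have key := expDecay_trichotomy hg0 (Real.one_le_rpow hc (by positivity : 0 ≤ 1 / q))
    (fun k => hgd k (k + 1) (h₁ k)) (fun k => hgd k (k - 1) (h₂ k)) (le_max_left _ _) hvb hvg
  have hga : (fun k => (g k)⁻¹) = fun k => a k ^ (1 / q) := by
    funext k
    simp only [hg, inv_inv]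
  rw [hga] at key
  exact key.imp (ExpDecay.of_rpow ha0 hq)
    (Or.imp (ExpDecay.of_rpow ha0 hq)
      (And.imp (ExpDecay.of_rpow ha0 hq) (ExpDecay.of_rpow ha0 hq)))

end Necessity

section Levels

variable {μ : Measure X} {f : Equiv.Perm X} {W : Set X}
  {p : ℝ≥0∞} [Fact (1 ≤ p)] {ρ : ℤ → X → ℝ≥0∞} {m M : ℤ → ℝ≥0∞}

theorem CondStar.exists_measure_img_succ_le (hd : IsDissipative μ f W)
    (h : CondStar μ f.symm) :
    ∃ c : ℝ≥0∞, c ≠ ⊤ ∧ ∀ k, μ (img f (k + 1) W) ≤ c * μ (img f k W) := by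
  obtain ⟨c, -, hc, h⟩ := h
  refine ⟨c, hc, fun k => ?_⟩
  convert h _ (hd.measurableSet_img k hd.meas_W) using 2
  rw [img_eq_preimage, img_eq_preimage, ← preimage_comp]
  congr 1
  ext x
  rw [neg_add, perm_zpow_add_apply, zpow_neg_one]
  rfl

theorem CondStar.exists_measure_img_pred_le (hd : IsDissipative μ f W) (h : CondStar μ f) :
    ∃ c : ℝ≥0∞, c ≠ ⊤ ∧ ∀ k, μ (img f (k - 1) W) ≤ c * μ (img f k W) := by
  obtain ⟨c, -, hc, h⟩ := h
  refine ⟨c, hc, fun k => ?_⟩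
  convert h _ (hd.measurableSet_img k hd.meas_W) using 2
  rw [img_eq_preimage, img_eq_preimage, ← preimage_comp]
  congr 1
  ext x
  rw [neg_sub, sub_eq_neg_add, perm_zpow_add_apply, zpow_one]
  rfl

theorem measure_img_ne_zero (hd : IsDissipative μ f W)
    (hρ : ∀ k : ℤ, ∀ B : Set X, MeasurableSet B → μ (img f k B) = ∫⁻ x in B, ρ k x ∂μ) (k : ℤ) :
    μ (img f k W) ≠ 0 := fun h0 => by
  have h := (quasiMeasurePreserving_zpow hd hρ k).preimage_null h0
  rw [img, (f ^ k).injective.preimage_image] at h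
  exact hd.pos.ne' h

theorem measure_img_ne_top (hd : IsDissipative μ f W) {c : ℝ≥0∞} (hc : c ≠ ⊤)
    (h₁ : ∀ k, μ (img f (k + 1) W) ≤ c * μ (img f k W))
    (h₂ : ∀ k, μ (img f (k - 1) W) ≤ c * μ (img f k W)) (k : ℤ) : μ (img f k W) ≠ ⊤ := by
  induction k using Int.induction_on with
  | zero => simpa [img] using hd.fin.ne
  | succ i ih => exact ne_top_of_le_ne_top (ENNReal.mul_ne_top hc ih) (h₁ _)
  | pred i ih => exact ne_top_of_le_ne_top (ENNReal.mul_ne_top hc ih) (h₂ _)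

/-- The half of the space formed by the levels of nonpositive index splits `L^p` into a
contracting and an expanding part. -/
theorem generalizedHyperbolic_of_expDecay (hp : p ≠ ⊤) (hd : IsDissipative μ f W)
    (hρmeas : ∀ k : ℤ, Measurable (ρ k))
    (hρ : ∀ k : ℤ, ∀ B : Set X, MeasurableSet B → μ (img f k B) = ∫⁻ x in B, ρ k x ∂μ)
    (hm : ∀ k, ∀ᵐ x ∂μ.restrict W, m k ≤ ρ k x) (hM : ∀ k, ∀ᵐ x ∂μ.restrict W, ρ k x ≤ M k)
    (hmt : ∀ k, m k ≠ ⊤) {C : ℝ} (hC : 1 ≤ C) (hMC : ∀ k, M k ≤ ENNReal.ofReal C * m k)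
    {T : Lp ℝ p μ ≃L[ℝ] Lp ℝ p μ} (hU : ∀ (n : ℕ) (φ : Lp ℝ p μ),
      ⇑((T ^ n) φ) =ᵐ[μ] fun x => φ ((f ^ (-(-1 * (n : ℤ)))) x))
    (hU' : ∀ (n : ℕ) (φ : Lp ℝ p μ),
      ⇑((T.symm ^ n) φ) =ᵐ[μ] fun x => φ ((f ^ (-(1 * (n : ℤ)))) x))
    (h₁ : ExpDecay (fun k => (m k).toReal) (-1) (Iic 0))
    (h₂ : ExpDecay (fun k => (m k).toReal) 1 (Ici 0)) : GeneralizedHyperbolic T := by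
  set A := ⋃ j ∈ Iic (0 : ℤ), img f j W with hA
  have hAm : MeasurableSet A :=
    MeasurableSet.biUnion (to_countable _) fun j _ => hd.measurableSet_img j hd.meas_W
  have hstep : ∀ x ∈ A, (f ^ (-1 : ℤ)) x ∈ A := fun x hx => by
    obtain ⟨j, hj, y, hy, rfl⟩ := mem_iUnion₂.1 hx
    refine mem_iUnion₂.2 ⟨-1 + j, ?_, y, hy, perm_zpow_add_apply f _ _ _⟩
    simp only [mem_Iic] at *
    omega
  have hq := quasiMeasurePreserving_zpow hd hρ
  refine ⟨vanishingOn μ p Aᶜ, vanishingOn μ p A, isClosed_vanishingOn _, isClosed_vanishingOn _,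
    isCompl_vanishingOn hAm, fun φ hφ => ?_, fun φ hφ => ?_, ?_, ?_⟩
  · rw [mem_vanishingOn hAm.compl] at hφ ⊢
    have e := hU 1 φ
    rw [pow_one, Nat.cast_one, mul_one, neg_neg] at e
    filter_upwards [e, (hq 1).ae hφ] with x hx h hxA
    rw [hx]
    refine h fun hfx => hxA ?_
    have := hstep _ hfx
    rwa [← perm_zpow_add_apply] at this
  · rw [mem_vanishingOn hAm] at hφ ⊢
    have e := hU' 1 φ
    rw [pow_one, Nat.cast_one, mul_one] at e
    filter_upwards [e, (hq (-1)).ae hφ] with x hx h hxA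
    rw [hx]
    exact h (hstep x hxA)
  · exact contractsOn_of_expDecay hp hd hρmeas hρ hm hM hmt hC hMC h₁ hU fun φ hφ =>
      (mem_vanishingOn hAm.compl).1 hφ
  · refine contractsOn_of_expDecay hp hd hρmeas hρ hm hM hmt hC hMC (h₂.mono Ioi_subset_Ici_self)
      hU' fun φ hφ => ?_
    filter_upwards [(mem_vanishingOn hAm).1 hφ] with x hx hxS
    refine hx ?_
    obtain ⟨j, hj⟩ := mem_iUnion.1 (hd.cover.symm ▸ mem_univ x : x ∈ ⋃ k : ℤ, img f k W)
    refine mem_iUnion₂.2 ⟨j, ?_, hj⟩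
    by_contra hj0
    exact hxS (mem_iUnion₂.2 ⟨j, mem_Ioi.2 (not_le.1 hj0), hj⟩)

theorem nontrivial_Lp_of_measure_pos {q : ℝ≥0∞} (hW : MeasurableSet W) (hpos : 0 < μ W)
    (hfin : μ W < ⊤) :
    Nontrivial (Lp ℝ q μ) := by
  refine ⟨indicatorConstLp q hW hfin.ne 1, 0, fun h => hpos.ne' ?_⟩
  have h0 := (Lp.eq_zero_iff_ae_eq_zero.1 h)
  have h1 := indicatorConstLp_coeFn (p := q) (hs := hW) (hμs := hfin.ne) (c := (1 : ℝ))
  refine measure_mono_null (fun x hx => ?_) (ae_iff.1 (h1.symm.trans h0))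
  simp [hx]

end Levels

/-- Theorem RN: with `m_k`, `M_k` the essential inf/sup over `W` of the
Radon–Nikodym derivatives `ρ_k = dμ(f^k)/dμ`, and `{M_k/m_k}` bounded, the composition
operator `T_f` has the shadowing property iff one of 𝓡𝓝𝓒, 𝓡𝓝𝓓, 𝓡𝓝𝓖𝓗 holds; moreover
these conditions respectively imply that `T_f` is a contraction, a dilation, and
generalized hyperbolic. -/
theorem theoremRN
    {X : Type*} [MeasurableSpace X] (μ : Measure X) (f : Equiv.Perm X) (W : Set X)
    (p : ℝ≥0∞) [Fact (1 ≤ p)] (hp : p ≠ ⊤)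
    (hdiss : IsDissipative μ f W)
    (hstar : CondStar μ f) (hstar' : CondStar μ f.symm)
    (ρ : ℤ → X → ℝ≥0∞) (hρmeas : ∀ k : ℤ, Measurable (ρ k))
    (hρ : ∀ k : ℤ, ∀ B : Set X, MeasurableSet B → μ (img f k B) = ∫⁻ x in B, ρ k x ∂μ)
    (m M : ℤ → ℝ≥0∞)
    (hm : ∀ k : ℤ, m k = essInf (ρ k) (μ.restrict W))
    (hM : ∀ k : ℤ, M k = essSup (ρ k) (μ.restrict W))
    (hbdd : ∃ C : ℝ≥0∞, C ≠ ⊤ ∧ ∀ k : ℤ, M k / m k ≤ C)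
    (T : Lp ℝ p μ ≃L[ℝ] Lp ℝ p μ) (hT : RepsComp μ p f T) :
    (HasShadowing T ↔
      (limsup (fun n : ℕ => ⨆ k : ℤ, (M k / m (k + (n : ℤ))) ^ (1 / (n : ℝ))) atTop < 1 ∨
       1 < liminf (fun n : ℕ => ⨅ k : ℤ, (M k / m (k + (n : ℤ))) ^ (1 / (n : ℝ))) atTop ∨
       (limsup (fun n : ℕ =>
          ⨆ j : ℕ, (M (-(j : ℤ) - (n : ℤ)) / m (-(j : ℤ))) ^ (1 / (n : ℝ))) atTop < 1 ∧
        1 < liminf (fun n : ℕ =>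
          ⨅ j : ℕ, (M (j : ℤ) / m ((j : ℤ) + (n : ℤ))) ^ (1 / (n : ℝ))) atTop))) ∧
    (limsup (fun n : ℕ => ⨆ k : ℤ, (M k / m (k + (n : ℤ))) ^ (1 / (n : ℝ))) atTop < 1 →
      SpectralRadiusLtOne (T : Lp ℝ p μ →L[ℝ] Lp ℝ p μ)) ∧
    (1 < liminf (fun n : ℕ => ⨅ k : ℤ, (M k / m (k + (n : ℤ))) ^ (1 / (n : ℝ))) atTop →
      SpectralRadiusLtOne (T.symm : Lp ℝ p μ →L[ℝ] Lp ℝ p μ)) ∧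
    ((limsup (fun n : ℕ =>
          ⨆ j : ℕ, (M (-(j : ℤ) - (n : ℤ)) / m (-(j : ℤ))) ^ (1 / (n : ℝ))) atTop < 1 ∧
        1 < liminf (fun n : ℕ =>
          ⨅ j : ℕ, (M (j : ℤ) / m ((j : ℤ) + (n : ℤ))) ^ (1 / (n : ℝ))) atTop) →
      GeneralizedHyperbolic T) := by
  have hm' : ∀ k, ∀ᵐ x ∂μ.restrict W, m k ≤ ρ k x := fun k => by
    rw [hm k]; exact ae_essInf_le
  have hM' : ∀ k, ∀ᵐ x ∂μ.restrict W, ρ k x ≤ M k := fun k => by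
    rw [hM k]; exact ENNReal.ae_le_essSup _
  have hW0 := hdiss.pos.ne'
  have hWt := hdiss.fin.ne
  have hmμ : ∀ k, m k * μ W ≤ μ (img f k W) := fun k => by
    rw [hρ k W hdiss.meas_W, ← setLIntegral_const]
    exact lintegral_mono_ae (hm' k)
  have hMμ : ∀ k, μ (img f k W) ≤ M k * μ W := fun k => by
    rw [hρ k W hdiss.meas_W, ← setLIntegral_const]
    exact lintegral_mono_ae (hM' k)
  obtain ⟨c₁, hc₁, hs₁⟩ := hstar'.exists_measure_img_succ_le hdiss
  obtain ⟨c₂, hc₂, hs₂⟩ := hstar.exists_measure_img_pred_le hdiss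
  obtain ⟨c, hc, hc1, hs₁, hs₂⟩ : ∃ c : ℝ≥0∞, c ≠ ⊤ ∧ 1 ≤ c ∧
      (∀ k, μ (img f (k + 1) W) ≤ c * μ (img f k W)) ∧
      ∀ k, μ (img f (k - 1) W) ≤ c * μ (img f k W) := by
    refine ⟨c₁ + c₂ + 1, by simp [hc₁, hc₂], le_add_self, fun k => (hs₁ k).trans ?_,
      fun k => (hs₂ k).trans ?_⟩
    · gcongr; exact le_self_add.trans le_self_add
    · gcongr; exact le_add_self.trans le_self_add
  have hμ0 := measure_img_ne_zero hdiss hρ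
  have hμt := measure_img_ne_top hdiss hc hs₁ hs₂
  have hM0 : ∀ k, M k ≠ 0 := fun k h => hμ0 k (by simpa [h] using hMμ k)
  have hmt : ∀ k, m k ≠ ⊤ := fun k h => hμt k (by simpa [h, hW0] using hmμ k)
  obtain ⟨C₀, hC₀, hb⟩ := hbdd
  have hm0 : ∀ k, m k ≠ 0 := fun k h =>
    hC₀ (top_le_iff.1 (by simpa [h, ENNReal.div_zero (hM0 k)] using hb k))
  obtain ⟨C, hC, hMC⟩ : ∃ C : ℝ, 1 ≤ C ∧ ∀ k, M k ≤ ENNReal.ofReal C * m k := by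
    have hCt : C₀ + 1 ≠ ⊤ := by simp [hC₀]
    refine ⟨(C₀ + 1).toReal, ?_, fun k => ?_⟩
    · rw [← ENNReal.toReal_one]
      exact ENNReal.toReal_mono hCt le_add_self
    · rw [ENNReal.ofReal_toReal hCt, ← ENNReal.div_le_iff (hm0 k) (hmt k)]
      exact (hb k).trans le_self_add
  have hMt : ∀ k, M k ≠ ⊤ := fun k =>
    ne_top_of_le_ne_top (ENNReal.mul_ne_top ENNReal.ofReal_ne_top (hmt k)) (hMC k)
  have ha0 : ∀ k, 0 < (m k).toReal := fun k => ENNReal.toReal_pos (hm0 k) (hmt k)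
  have hab : ∀ k, (m k).toReal ≤ (M k).toReal := fun k =>
    ENNReal.toReal_mono (hMt k)
      ((ENNReal.mul_le_mul_iff_left hW0 hWt).1 ((hmμ k).trans (hMμ k)))
  have hba : ∀ k, (M k).toReal ≤ C * (m k).toReal := fun k => by
    have := ENNReal.toReal_mono (ENNReal.mul_ne_top ENNReal.ofReal_ne_top (hmt k)) (hMC k)
    rwa [ENNReal.toReal_mul, ENNReal.toReal_ofReal (by linarith)] at this
  have haa : ∀ k, (m k).toReal ≤ C * (m k).toReal := fun k =>
    le_mul_of_one_le_left (ha0 k).le hC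
  have hcC : 1 ≤ c.toReal * C := by
    refine one_le_mul_of_one_le_of_one_le ?_ hC
    rw [← ENNReal.toReal_one]
    exact ENNReal.toReal_mono hc hc1
  have hdbl : ∀ k l, μ (img f l W) ≤ c * μ (img f k W) →
      (m l).toReal ≤ c.toReal * C * (m k).toReal := fun k l h => by
    have h1 : m l * μ W ≤ c * M k * μ W := by
      rw [mul_assoc]
      exact (hmμ l).trans (h.trans (by gcongr; exact hMμ k))
    have h2 := ENNReal.toReal_mono (ENNReal.mul_ne_top hc (hMt k))
      ((ENNReal.mul_le_mul_iff_left hW0 hWt).1 h1)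
    rw [ENNReal.toReal_mul] at h2
    rw [mul_assoc]
    exact h2.trans (by gcongr; exact hba k)
  have h₁ : ∀ k, (m (k + 1)).toReal ≤ c.toReal * C * (m k).toReal := fun k => hdbl _ _ (hs₁ k)
  have h₂ : ∀ k, (m (k - 1)).toReal ≤ c.toReal * C * (m k).toReal := fun k => hdbl _ _ (hs₂ k)
  have hC_iff : limsup (fun n : ℕ => ⨆ k : ℤ, (M k / m (k + (n : ℤ))) ^ (1 / (n : ℝ))) atTop < 1 ↔
      ExpDecay (fun k => (m k).toReal) (-1) univ :=
    (limsup_iSup_rpow_lt_one_iff hMt hm0 hmt (fun k _ => k) fun k n => k + (n : ℤ)).trans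
      (rootBound_iff_expDecay hC hcC ha0 hab hba (fun _ => le_rfl) haa h₂
        (fun i n => by ring) (fun _ _ => mem_univ _) fun n k _ => ⟨k - n, by ring⟩)
  have hD_iff : 1 < liminf (fun n : ℕ =>
      ⨅ k : ℤ, (M k / m (k + (n : ℤ))) ^ (1 / (n : ℝ))) atTop ↔
      ExpDecay (fun k => (m k).toReal) 1 univ :=
    (one_lt_liminf_iInf_rpow_iff hM0 hMt hm0 hmt (fun k _ => k) fun k n => k + (n : ℤ)).trans
      (rootBound_iff_expDecay hC hcC ha0 (fun _ => le_rfl) haa hab hba h₁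
        (σ := fun k n => k + (n : ℤ)) (τ := fun k _ => k)
        (fun i n => by ring) (fun _ _ => mem_univ _) fun n k _ => ⟨k, rfl⟩)
  have hG₁_iff : limsup (fun n : ℕ =>
      ⨆ j : ℕ, (M (-(j : ℤ) - (n : ℤ)) / m (-(j : ℤ))) ^ (1 / (n : ℝ))) atTop < 1 ↔
      ExpDecay (fun k => (m k).toReal) (-1) (Iic 0) :=
    (limsup_iSup_rpow_lt_one_iff hMt hm0 hmt (fun (j : ℕ) n => -(j : ℤ) - (n : ℤ))
      fun j _ => -(j : ℤ)).trans
      (rootBound_iff_expDecay hC hcC ha0 hab hba (fun _ => le_rfl) haa h₂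
        (fun i n => by ring) (fun j _ => by simp)
        fun n k hk => ⟨k.natAbs, by simp only [mem_Iic] at hk; omega⟩)
  have hG₂_iff : 1 < liminf (fun n : ℕ =>
      ⨅ j : ℕ, (M (j : ℤ) / m ((j : ℤ) + (n : ℤ))) ^ (1 / (n : ℝ))) atTop ↔
      ExpDecay (fun k => (m k).toReal) 1 (Ici 0) :=
    (one_lt_liminf_iInf_rpow_iff hM0 hMt hm0 hmt (fun (j : ℕ) _ => (j : ℤ))
      fun j n => (j : ℤ) + (n : ℤ)).trans
      (rootBound_iff_expDecay hC hcC ha0 (fun _ => le_rfl) haa hab hba h₁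
        (σ := fun (j : ℕ) n => (j : ℤ) + (n : ℤ)) (τ := fun j _ => (j : ℤ))
        (fun i n => by ring) (fun j _ => by simp)
        fun n k hk => ⟨k.natAbs, by simp only [mem_Ici] at hk; omega⟩)
  rw [hC_iff, hD_iff, hG₁_iff, hG₂_iff]
  have hq := quasiMeasurePreserving_zpow hdiss hρ
  have hU : ∀ (n : ℕ) (φ : Lp ℝ p μ),
      ⇑((T ^ n) φ) =ᵐ[μ] fun x => φ ((f ^ (-(-1 * (n : ℤ)))) x) := fun n φ => by
    rw [neg_one_mul, neg_neg, ← zpow_natCast]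
    exact hT.zpow_ae_eq hq n φ
  have hU' : ∀ (n : ℕ) (φ : Lp ℝ p μ),
      ⇑((T.symm ^ n) φ) =ᵐ[μ] fun x => φ ((f ^ (-(1 * (n : ℤ)))) x) := fun n φ => by
    have e : T.symm ^ n = T ^ (-(n : ℤ)) := by
      rw [zpow_neg, zpow_natCast, ← inv_pow]
      rfl
    rw [one_mul, e]
    exact hT.zpow_ae_eq hq _ φ
  have htop : ∀ φ ∈ (⊤ : Submodule ℝ (Lp ℝ p μ)),
      ∀ᵐ x ∂μ, x ∉ (⋃ j ∈ (univ : Set ℤ), img f j W) → φ x = 0 := fun φ _ =>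
    ae_of_all _ fun x hx => absurd (by simp [hdiss.cover]) hx
  have hc_top : ExpDecay (fun k => (m k).toReal) (-1) univ → ContractsOn T ⊤ := fun h =>
    contractsOn_of_expDecay hp hdiss hρmeas hρ hm' hM' hmt hC hMC h hU htop
  have hd_top : ExpDecay (fun k => (m k).toReal) 1 univ → ContractsOn T.symm ⊤ := fun h =>
    contractsOn_of_expDecay hp hdiss hρmeas hρ hm' hM' hmt hC hMC h hU' htop
  have hgh : ExpDecay (fun k => (m k).toReal) (-1) (Iic 0) ∧
      ExpDecay (fun k => (m k).toReal) 1 (Ici 0) → GeneralizedHyperbolic T := fun h =>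
    generalizedHyperbolic_of_expDecay hp hdiss hρmeas hρ hm' hM' hmt hC hMC hU hU' h.1 h.2
  have hnt : Nontrivial (Lp ℝ p μ) :=
    nontrivial_Lp_of_measure_pos hdiss.meas_W hdiss.pos hdiss.fin
  refine ⟨⟨HasShadowing.expDecay hp hdiss hρmeas hρ hm' hM' hm0 hmt hC hMC hcC h₁ h₂ hT, ?_⟩,
    fun h => (hc_top h).spectralRadiusLtOne, fun h => (hd_top h).spectralRadiusLtOne, hgh⟩
  rintro (h | h | h)
  · exact (generalizedHyperbolic_of_contractsOn_top (hc_top h)).hasShadowing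
  · exact (generalizedHyperbolic_of_symm_contractsOn_top (hd_top h)).hasShadowing
  · exact (hgh h).hasShadowing

end GHShadow
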